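/- arXiv:2303.11260 — 5 statements merged into one kernel-verified Lean document; each statement's English description precedes it below -/
import Mathlib

section
/- Let Φ be a finite reduced crystallographic root system spanning a finite-dimensional real inner product space V, with Weyl group W and base of simple roots Δ. For roots α, β write n(α,β) = 2⟨α,β⟩/⟨β,β⟩ (an integer). Then two simple roots α, β ∈ Δ lie in the same W-orbit if and only if there is a finite sequence of simple roots α = γ_0, γ_1, …, γ_m = β in Δ such that n(γ_i, γ_{i+1})·n(γ_{i+1}, γ_i) = 1 for every 0 ≤ i < m, i.e. consecutive terms are joined by a single edge in the Dynkin diagram. -/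
open scoped RealInnerProductSpace

/-- A reduced crystallographic root system in a real inner product space, together with a base
that is a basis `b` of the ambient space. The isometry `s α` is the reflection in the root `α`. -/
structure BasedRootSystem (ι V : Type*) [NormedAddCommGroup V] [InnerProductSpace ℝ V] where
  Φ : Set V
  s : V → (V ≃ₗᵢ[ℝ] V)
  b : Module.Basis ι ℝ V
  finite : Φ.Finite
  zero_notMem : (0 : V) ∉ Φ
  s_apply : ∀ α ∈ Φ, ∀ x : V, s α x = x - (2 * ⟪α, x⟫ / ⟪α, α⟫) • α
  s_mem : ∀ α ∈ Φ, ∀ β ∈ Φ, s α β ∈ Φ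
  reduced : ∀ α ∈ Φ, ∀ t : ℝ, t • α ∈ Φ → t = 1 ∨ t = -1
  integral : ∀ α ∈ Φ, ∀ β ∈ Φ, ∃ k : ℤ, 2 * ⟪α, β⟫ / ⟪β, β⟫ = (k : ℝ)
  b_mem : ∀ i, b i ∈ Φ
  sign : ∀ β ∈ Φ, (∀ i, 0 ≤ b.repr β i) ∨ (∀ i, b.repr β i ≤ 0)

namespace BasedRootSystem

variable {ι V : Type*} [NormedAddCommGroup V] [InnerProductSpace ℝ V]
  (R : BasedRootSystem ι V)

/-- A vector is nonnegative if all its coordinates in the base are. -/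
def Pos (v : V) : Prop := ∀ i, 0 ≤ R.b.repr v i

/-- The product of the simple reflections listed in a word. -/
noncomputable def wordProd (l : List ι) : V ≃ₗᵢ[ℝ] V := (l.map fun i => R.s (R.b i)).prod

/-- Two vectors are joined by a single edge. -/
def SingleEdge (α β : V) : Prop :=
  (2 * ⟪α, β⟫ / ⟪β, β⟫) * (2 * ⟪β, α⟫ / ⟪α, α⟫) = 1

@[simp] lemma wordProd_nil : R.wordProd [] = 1 := rfl

@[simp] lemma wordProd_cons (i : ι) (l : List ι) :
    R.wordProd (i :: l) = R.s (R.b i) * R.wordProd l := by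
  simp [wordProd]

@[simp] lemma wordProd_append (l l' : List ι) :
    R.wordProd (l ++ l') = R.wordProd l * R.wordProd l' := by
  simp [wordProd]

variable {R}

lemma isometry_mul_apply (f g : V ≃ₗᵢ[ℝ] V) (x : V) : (f * g) x = f (g x) := rfl

lemma ne_zero {α : V} (hα : α ∈ R.Φ) : α ≠ 0 := fun h => R.zero_notMem (h ▸ hα)

lemma inner_self_pos {α : V} (hα : α ∈ R.Φ) : 0 < ⟪α, α⟫ :=
  real_inner_self_pos.2 (ne_zero hα)

lemma s_self {α : V} (hα : α ∈ R.Φ) : R.s α α = -α := by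
  rw [R.s_apply α hα, mul_div_assoc, div_self (inner_self_pos hα).ne', mul_one, two_smul]
  abel

lemma neg_mem {α : V} (hα : α ∈ R.Φ) : -α ∈ R.Φ := s_self hα ▸ R.s_mem α hα α hα

lemma s_neg {α : V} (hα : α ∈ R.Φ) : R.s (-α) = R.s α := by
  ext x
  rw [R.s_apply α hα, R.s_apply _ (neg_mem hα)]
  simp [neg_div]

lemma s_conj {α : V} (hα : α ∈ R.Φ) (w : V ≃ₗᵢ[ℝ] V) (hw : w α ∈ R.Φ) :
    R.s (w α) * w = w * R.s α := by
  ext x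
  simp [isometry_mul_apply, R.s_apply α hα, R.s_apply _ hw]

lemma s_mul_self {α : V} (hα : α ∈ R.Φ) : R.s α * R.s α = 1 := by
  ext x
  have hx : R.s α α = -α := s_self hα
  rw [isometry_mul_apply, R.s_apply α hα x, map_sub, map_smul, hx, R.s_apply α hα x]
  simp

lemma s_inv {α : V} (hα : α ∈ R.Φ) : (R.s α)⁻¹ = R.s α :=
  inv_eq_of_mul_eq_one_left (s_mul_self hα)

lemma pos_b (i : ι) : R.Pos (R.b i) := by
  classical
  intro j
  rw [R.b.repr_self, Finsupp.single_apply]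
  split_ifs <;> norm_num

lemma pos_of_coord_pos {β : V} (hβ : β ∈ R.Φ) {j : ι} (hj : 0 < R.b.repr β j) : R.Pos β :=
  (R.sign β hβ).resolve_right fun h => (h j).not_gt hj

lemma pos_neg_of_not_pos {β : V} (hβ : β ∈ R.Φ) (h : ¬ R.Pos β) : R.Pos (-β) := by
  intro i
  simpa using (R.sign β hβ).resolve_left h i

lemma not_pos_neg {β : V} (hβ : β ∈ R.Φ) (h : R.Pos β) : ¬ R.Pos (-β) := by
  intro h'
  refine ne_zero hβ (R.b.repr.map_eq_zero_iff.1 ?_)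
  ext i
  have h1 := h i
  have h2 := h' i
  simp only [map_neg, Finsupp.coe_neg, Pi.neg_apply] at h2
  simp only [Finsupp.coe_zero, Pi.zero_apply]
  linarith

lemma eq_smul_of_coord_eq_zero {v : V} {i : ι} (h : ∀ j, j ≠ i → R.b.repr v j = 0) :
    v = R.b.repr v i • R.b i := by
  classical
  apply R.b.repr.injective
  ext j
  rw [map_smul, R.b.repr_self, Finsupp.smul_apply, Finsupp.single_apply]
  split_ifs with hj
  · simp [hj]
  · simpa using h j (Ne.symm hj)

lemma eq_of_smul_mem {α : V} (hα : α ∈ R.Φ) {t : ℝ} (ht : 0 ≤ t) (h : t • α ∈ R.Φ) :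
    t • α = α := by
  rcases R.reduced α hα t h with rfl | rfl
  · simp
  · norm_num at ht

/-- A simple reflection permutes the positive roots other than its own simple root. -/
lemma pos_s_of_pos {β : V} (hβ : β ∈ R.Φ) (hpos : R.Pos β) {i : ι} (hne : β ≠ R.b i) :
    R.Pos (R.s (R.b i) β) := by
  obtain ⟨j, hji, hj⟩ : ∃ j, j ≠ i ∧ R.b.repr β j ≠ 0 := by
    by_contra! h
    have h1 := eq_smul_of_coord_eq_zero h
    apply hne
    have h2 := eq_of_smul_mem (R.b_mem i) (hpos i) (h1 ▸ hβ)
    rwa [← h1] at h2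
  refine pos_of_coord_pos (R.s_mem _ (R.b_mem i) _ hβ) (j := j) ?_
  rw [R.s_apply _ (R.b_mem i)]
  simpa [hji.symm] using lt_of_le_of_ne (hpos j) hj.symm

lemma wordProd_mem (l : List ι) {β : V} (hβ : β ∈ R.Φ) : R.wordProd l β ∈ R.Φ := by
  induction l with
  | nil => simpa
  | cons i l ih =>
    rw [wordProd_cons, isometry_mul_apply]
    exact R.s_mem _ (R.b_mem i) _ ih

/-- The exchange property. -/
lemma exists_word_of_not_pos (l : List ι) (i : ι) (h : ¬ R.Pos (R.wordProd l (R.b i))) :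
    ∃ l' : List ι, l'.length < l.length ∧ R.wordProd l' = R.wordProd l * R.s (R.b i) := by
  induction l with
  | nil => exact absurd (pos_b i) (by simpa using h)
  | cons j t ih =>
    by_cases ht : R.Pos (R.wordProd t (R.b i))
    · have hmem := wordProd_mem t (R.b_mem i)
      have heq : R.wordProd t (R.b i) = R.b j := by
        by_contra hne
        exact h (by simpa using pos_s_of_pos hmem ht hne)
      refine ⟨t, by simp, ?_⟩
      have hc := s_conj (R.b_mem i) (R.wordProd t) hmem
      rw [heq] at hc
      rw [wordProd_cons, mul_assoc, ← hc, ← mul_assoc, s_mul_self (R.b_mem j), one_mul]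
    · obtain ⟨t', hlen, ht'⟩ := ih ht
      exact ⟨j :: t', by simpa using hlen, by simp [ht', mul_assoc]⟩

lemma exists_word_of_mem_closure {w : V ≃ₗᵢ[ℝ] V}
    (hw : w ∈ Subgroup.closure (Set.range fun i => R.s (R.b i))) :
    ∃ l : List ι, R.wordProd l = w := by
  induction hw using Subgroup.closure_induction with
  | mem x hx =>
    obtain ⟨i, rfl⟩ := hx
    exact ⟨[i], by simp⟩
  | one => exact ⟨[], rfl⟩
  | mul x y _ _ hx hy =>
    obtain ⟨l, rfl⟩ := hx
    obtain ⟨l', rfl⟩ := hy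
    exact ⟨l ++ l', by simp⟩
  | inv x _ hx =>
    obtain ⟨l, rfl⟩ := hx
    refine ⟨l.reverse, ?_⟩
    clear * -
    induction l with
    | nil => simp
    | cons i l ih => simp [ih, s_inv (R.b_mem i)]

lemma exists_inner_pos [Fintype ι] {β : V} (hβ : β ∈ R.Φ) (hpos : R.Pos β) :
    ∃ i, 0 < ⟪R.b i, β⟫ := by
  by_contra! h
  have h1 : ⟪β, β⟫ = ∑ i, R.b.repr β i * ⟪R.b i, β⟫ := by
    conv_lhs => rw [← R.b.sum_repr β, sum_inner]
    simp [real_inner_smul_left, R.b.sum_repr β]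
  have h2 := inner_self_pos hβ
  rw [h1] at h2
  exact h2.not_ge (Finset.sum_nonpos fun i _ =>
    mul_nonpos_of_nonneg_of_nonpos (hpos i) (h i))

/-- Every reflection is a product of simple reflections. -/
lemma s_mem_closure [Fintype ι] {β : V} (hβ : β ∈ R.Φ) :
    R.s β ∈ Subgroup.closure (Set.range fun i => R.s (R.b i)) := by
  wlog hpos : R.Pos β generalizing β
  · rw [← s_neg hβ]
    exact this (neg_mem hβ) (pos_neg_of_not_pos hβ hpos)
  set H := Subgroup.closure (Set.range fun i => R.s (R.b i))
  have hgen : ∀ i, R.s (R.b i) ∈ H := fun i => Subgroup.subset_closure ⟨i, rfl⟩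
  let S : Set V := {v | v ∈ R.Φ ∧ R.Pos v ∧ ∃ w ∈ H, w β = v}
  obtain ⟨v, ⟨hvΦ, hvpos, w, hw, rfl⟩, hmin⟩ :=
    Set.exists_min_image S (fun v => ∑ i, R.b.repr v i) (R.finite.subset fun v hv => hv.1)
      ⟨β, hβ, hpos, 1, one_mem _, rfl⟩
  obtain ⟨i, hi⟩ := exists_inner_pos hvΦ hvpos
  have hwi : w β = R.b i := by
    by_contra hne
    have hle := hmin (R.s (R.b i) (w β)) ⟨R.s_mem _ (R.b_mem i) _ hvΦ,
      pos_s_of_pos hvΦ hvpos hne, R.s (R.b i) * w, mul_mem (hgen i) hw, rfl⟩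
    have hc : 0 < 2 * ⟪R.b i, w β⟫ / ⟪R.b i, R.b i⟫ :=
      div_pos (by linarith) (inner_self_pos (R.b_mem i))
    classical
    rw [R.s_apply _ (R.b_mem i)] at hle
    simp only [map_sub, map_smul, Finsupp.sub_apply, Finsupp.smul_apply, R.b.repr_self,
      Finset.sum_sub_distrib, Finsupp.single_apply, smul_eq_mul, mul_ite, mul_one, mul_zero,
      Finset.sum_ite_eq, Finset.mem_univ, if_true] at hle
    linarith
  have hc := s_conj hβ w hvΦ
  rw [hwi] at hc
  have : R.s β = w⁻¹ * (R.s (R.b i) * w) := by rw [hc, inv_mul_cancel_left]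
  rw [this]
  exact mul_mem (inv_mem hw) (mul_mem (hgen i) hw)

/-- A property of a vector that is preserved by two simple reflections holds along the orbit of
the parabolic subgroup they generate. -/
lemma apply_mem_of_mem_closure_pair {i k : ι} (p : V → Prop)
    (hi : ∀ v, p v → p (R.s (R.b i) v)) (hk : ∀ v, p v → p (R.s (R.b k) v))
    {u : V ≃ₗᵢ[ℝ] V} (hu : u ∈ Subgroup.closure {R.s (R.b i), R.s (R.b k)}) {v : V} (hv : p v) :
    p (u v) := by
  have key : ∀ v, (p v → p (u v)) ∧ (p v → p (u⁻¹ v)) := by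
    induction hu using Subgroup.closure_induction with
    | mem x hx =>
      rcases hx with rfl | rfl
      · rw [s_inv (R.b_mem i)]
        exact fun v => ⟨hi v, hi v⟩
      · rw [s_inv (R.b_mem k)]
        exact fun v => ⟨hk v, hk v⟩
    | one => simp
    | mul x y _ _ hx hy =>
      refine fun v => ⟨fun h => (hx _).1 ((hy _).1 h), fun h => ?_⟩
      rw [mul_inv_rev]
      exact (hy _).2 ((hx _).2 h)
    | inv x _ hx =>
      intro v
      rw [inv_inv]
      exact (hx v).symm
  exact (key v).1 hv

/-- Distinct simple roots conjugate under the parabolic subgroup they generate are joined by a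
single edge. -/
lemma singleEdge_of_apply_eq {i k : ι} (hik : i ≠ k) {u : V ≃ₗᵢ[ℝ] V}
    (hu : u ∈ Subgroup.closure {R.s (R.b i), R.s (R.b k)}) (h : u (R.b i) = R.b k) :
    SingleEdge (R.b i) (R.b k) := by
  have hnorm : ⟪R.b k, R.b k⟫ = ⟪R.b i, R.b i⟫ := by rw [← h, u.inner_map_map]
  have hpos := inner_self_pos (R.b_mem i)
  have hli : ∀ t : ℝ, R.b k ≠ t • R.b i := by
    intro t ht
    have := congrArg (fun v => R.b.repr v k) ht
    simp [hik] at this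
  have hne : ⟪R.b i, R.b k⟫ ≠ 0 := by
    intro h0
    have hp := apply_mem_of_mem_closure_pair (R := R) (i := i) (k := k)
      (fun v => ∃ t : ℝ, v = t • R.b i) ?_ ?_ hu (v := R.b i) ⟨1, by simp⟩
    · obtain ⟨t, ht⟩ := hp
      exact hli t (h ▸ ht)
    · rintro v ⟨t, rfl⟩
      exact ⟨-t, by rw [map_smul, s_self (R.b_mem i)]; simp⟩
    · rintro v ⟨t, rfl⟩
      refine ⟨t, ?_⟩
      rw [R.s_apply _ (R.b_mem k), real_inner_smul_right, real_inner_comm, h0]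
      simp
  obtain ⟨z, hz⟩ := R.integral _ (R.b_mem i) _ (R.b_mem k)
  have hlt : ⟪R.b i, R.b k⟫ ^ 2 < ⟪R.b i, R.b i⟫ ^ 2 := by
    have h1 : 0 < ⟪R.b k - (⟪R.b i, R.b k⟫ / ⟪R.b i, R.b i⟫) • R.b i,
        R.b k - (⟪R.b i, R.b k⟫ / ⟪R.b i, R.b i⟫) • R.b i⟫ :=
      real_inner_self_pos.2 (sub_ne_zero.2 (hli _))
    have h2 : ⟪R.b k, R.b i⟫ = ⟪R.b i, R.b k⟫ := real_inner_comm _ _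
    simp only [inner_sub_left, inner_sub_right, real_inner_smul_left, real_inner_smul_right,
      hnorm, h2] at h1
    field_simp at h1
    nlinarith
  rw [SingleEdge, real_inner_comm (R.b i) (R.b k), ← hnorm, hz]
  rw [hnorm] at hz
  rw [div_eq_iff hpos.ne'] at hz
  have hz0 : z ≠ 0 := by
    rintro rfl
    apply hne
    simpa using hz
  have hz4 : z ^ 2 < 4 := by
    have : (z : ℝ) ^ 2 * ⟪R.b i, R.b i⟫ ^ 2 < 4 * ⟪R.b i, R.b i⟫ ^ 2 := by
      rw [← mul_pow, ← hz]
      linarith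
    exact_mod_cast lt_of_mul_lt_mul_right this (by positivity)
  have hle : z < 2 := by nlinarith
  have hge : -2 < z := by nlinarith
  have : z * z = 1 := by
    interval_cases z <;> simp_all
  exact_mod_cast this

/-- A simple root which is a nonnegative combination of the images of two distinct simple roots
is a multiple of one of them. -/
lemma eq_zero_or_eq_zero_of_combination {i k j : ι} (hik : i ≠ k) (w : V ≃ₗᵢ[ℝ] V)
    (hwi : R.Pos (w (R.b i))) (hwk : R.Pos (w (R.b k))) {x y : ℝ} (hx : 0 ≤ x) (hy : 0 ≤ y)
    (h : w (x • R.b i + y • R.b k) = R.b j) : x = 0 ∨ y = 0 := by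
  by_contra! hxy
  have hx' := lt_of_le_of_ne hx hxy.1.symm
  have hy' := lt_of_le_of_ne hy hxy.2.symm
  have hcoord : ∀ m, m ≠ j → x * R.b.repr (w (R.b i)) m + y * R.b.repr (w (R.b k)) m = 0 := by
    intro m hm
    have := congrArg (fun v => R.b.repr v m) h
    simpa [hm.symm] using this
  have hA := eq_smul_of_coord_eq_zero (R := R) (v := w (R.b i)) (i := j) fun m hm => by
    have := hcoord m hm
    nlinarith [hwi m, mul_nonneg hy (hwk m), mul_nonneg hx (hwi m)]
  have hB := eq_smul_of_coord_eq_zero (R := R) (v := w (R.b k)) (i := j) fun m hm => by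
    have := hcoord m hm
    nlinarith [hwk m, mul_nonneg hy (hwk m), mul_nonneg hx (hwi m)]
  set c := R.b.repr (w (R.b i)) j
  set d := R.b.repr (w (R.b k)) j
  have hcd : w (d • R.b i) = w (c • R.b k) := by
    rw [map_smul, map_smul, hA, hB, smul_smul, smul_smul, mul_comm]
  have hcd' := w.injective hcd
  have hc0 : c = 0 := by
    have := congrArg (fun v => R.b.repr v k) hcd'
    simpa [hik] using this.symm
  rw [hc0, zero_smul] at hA
  exact ne_zero (R.b_mem i) (w.map_eq_zero_iff.1 hA)

/-- Simple roots conjugate under a product of simple reflections are linked by single edges. -/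
lemma reflTransGen_of_wordProd_apply (l : List ι) (i j : ι)
    (h : R.wordProd l (R.b i) = R.b j) :
    Relation.ReflTransGen (fun i k => SingleEdge (R.b i) (R.b k)) i j := by
  induction hn : l.length using Nat.strong_induction_on generalizing l i with
  | _ n ih =>
  rcases l.eq_nil_or_concat' with rfl | ⟨t, k, rfl⟩
  · have : i = j := R.b.injective (by simpa using h)
    exact this ▸ .refl
  have hlen : t.length < n := by rw [← hn]; simp
  by_cases hki : k = i
  · subst hki
    have ht : R.wordProd t (R.b k) = -R.b j := by
      rw [← h]
      simp [s_self (R.b_mem k)]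
    obtain ⟨t', hlt, ht'⟩ := exists_word_of_not_pos t k
      (ht ▸ not_pos_neg (R.b_mem j) (pos_b j))
    refine ih _ (hlt.trans hlen) t' k ?_ rfl
    rw [ht', ← h]
    simp
  have hik : i ≠ k := Ne.symm hki
  set P := Subgroup.closure {R.s (R.b i), R.s (R.b k)}
  have hiP : R.s (R.b i) ∈ P := Subgroup.subset_closure (by simp)
  have hkP : R.s (R.b k) ∈ P := Subgroup.subset_closure (by simp)
  let S : Set (List ι) := {l' | ∃ u ∈ P, R.wordProd l' * u = R.wordProd (t ++ [k])}
  have htS : t ∈ S := ⟨_, hkP, by simp⟩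
  obtain ⟨l', ⟨u, hu, hlu⟩, hmin⟩ : ∃ l' ∈ S, ∀ m ∈ S, l'.length ≤ m.length := by
    refine ⟨Function.argminOn List.length S ⟨t, htS⟩, Function.argminOn_mem _ _ _, fun m hm => ?_⟩
    exact Function.argminOn_le _ _ hm
  have hlt : l'.length < n := (hmin t htS).trans_lt hlen
  have hposP : ∀ m, R.s (R.b m) ∈ P → R.Pos (R.wordProd l' (R.b m)) := by
    intro m hm
    by_contra hneg
    obtain ⟨l'', hshort, hl''⟩ := exists_word_of_not_pos l' m hneg
    refine hshort.not_ge (hmin l'' ⟨R.s (R.b m) * u, mul_mem hm hu, ?_⟩)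
    rw [hl'', ← hlu, mul_assoc, ← mul_assoc (R.s (R.b m)), s_mul_self (R.b_mem m), one_mul]
  have hspan : ∃ x y : ℝ, u (R.b i) = x • R.b i + y • R.b k := by
    refine apply_mem_of_mem_closure_pair (R := R) (i := i) (k := k)
      (fun v => ∃ x y : ℝ, v = x • R.b i + y • R.b k) ?_ ?_ hu ⟨1, 0, by simp⟩
    · rintro v ⟨x, y, rfl⟩
      rw [R.s_apply _ (R.b_mem i)]
      exact ⟨x - _, y, by rw [sub_smul, add_sub_right_comm]⟩
    · rintro v ⟨x, y, rfl⟩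
      rw [R.s_apply _ (R.b_mem k)]
      exact ⟨x, y - _, by rw [sub_smul, add_sub_assoc]⟩
  obtain ⟨x, y, hxy⟩ := hspan
  have huΦ : u (R.b i) ∈ R.Φ := apply_mem_of_mem_closure_pair (R := R) (i := i) (k := k)
    (· ∈ R.Φ) (R.s_mem _ (R.b_mem i)) (R.s_mem _ (R.b_mem k)) hu (R.b_mem i)
  have hj : R.wordProd l' (u (R.b i)) = R.b j := by
    rw [← h, ← hlu, isometry_mul_apply]
  have hnonneg : 0 ≤ x ∧ 0 ≤ y := by
    have hxi : R.b.repr (u (R.b i)) i = x := by simp [hxy, hik]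
    have hyk : R.b.repr (u (R.b i)) k = y := by simp [hxy, hik]
    rcases R.sign _ huΦ with hs | hs
    · exact ⟨hxi ▸ hs i, hyk ▸ hs k⟩
    · have hx := hxi ▸ hs i
      have hy := hyk ▸ hs k
      have hjj := congrArg (fun v => R.b.repr v j) hj
      rw [hxy] at hjj
      simp only [map_add, map_smul, Finsupp.add_apply, Finsupp.smul_apply, smul_eq_mul,
        R.b.repr_self, Finsupp.single_eq_same] at hjj
      nlinarith [mul_nonneg (neg_nonneg.2 hx) (hposP i hiP j),
        mul_nonneg (neg_nonneg.2 hy) (hposP k hkP j)]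
  rcases eq_zero_or_eq_zero_of_combination hik _ (hposP i hiP) (hposP k hkP) hnonneg.1 hnonneg.2
    (hxy ▸ hj) with rfl | rfl
  · rw [zero_smul, zero_add] at hxy
    have huk : u (R.b i) = R.b k :=
      hxy.trans (eq_of_smul_mem (R.b_mem k) hnonneg.2 (hxy ▸ huΦ))
    exact .head (singleEdge_of_apply_eq hik hu huk) (ih _ hlt l' k (huk ▸ hj) rfl)
  · rw [zero_smul, add_zero] at hxy
    have hui : u (R.b i) = R.b i :=
      hxy.trans (eq_of_smul_mem (R.b_mem i) hnonneg.1 (hxy ▸ huΦ))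
    exact ih _ hlt l' i (by rwa [hui] at hj) rfl

/-- Roots joined by a single edge are conjugate. -/
lemma exists_apply_eq_of_singleEdge {α β : V} (hα : α ∈ R.Φ) (hβ : β ∈ R.Φ)
    (h : SingleEdge α β) : ∃ w ∈ Subgroup.closure (R.s '' R.Φ), w α = β := by
  have hsα : R.s α ∈ Subgroup.closure (R.s '' R.Φ) := Subgroup.subset_closure ⟨α, hα, rfl⟩
  have hsβ : R.s β ∈ Subgroup.closure (R.s '' R.Φ) := Subgroup.subset_closure ⟨β, hβ, rfl⟩
  have hβα := R.s_apply β hβ α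
  have hαβ := R.s_apply α hα β
  obtain ⟨p, hp⟩ := R.integral α hα β hβ
  obtain ⟨q, hq⟩ := R.integral β hβ α hα
  rw [SingleEdge, hp, hq] at h
  rw [real_inner_comm, hp] at hβα
  rw [real_inner_comm, hq] at hαβ
  have h' : p * q = 1 := by exact_mod_cast h
  rcases Int.mul_eq_one_iff_eq_one_or_neg_one.1 h' with ⟨rfl, rfl⟩ | ⟨rfl, rfl⟩
  · refine ⟨R.s β * (R.s α * R.s β), mul_mem hsβ (mul_mem hsα hsβ), ?_⟩
    simp [hβα, hαβ, s_self hα, s_self hβ]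
    abel
  · refine ⟨R.s α * R.s β, mul_mem hsα hsβ, ?_⟩
    simp [hβα, hαβ, s_self hα]

end BasedRootSystem

lemma Relation.ReflTransGen.exists_fin_chain {α : Type*} {r : α → α → Prop} {a b : α}
    (h : Relation.ReflTransGen r a b) :
    ∃ (m : ℕ) (γ : Fin (m + 1) → α), γ 0 = a ∧ γ (Fin.last m) = b ∧
      ∀ i : Fin m, r (γ i.castSucc) (γ i.succ) := by
  induction h with
  | refl => exact ⟨0, fun _ => a, rfl, rfl, fun i => i.elim0⟩
  | @tail b c _ hbc ih =>
    obtain ⟨m, γ, h0, hl, hs⟩ := ih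
    refine ⟨m + 1, Fin.snoc γ c, ?_, by simp, fun i => ?_⟩
    · rw [← h0, ← Fin.castSucc_zero, Fin.snoc_castSucc]
    · induction i using Fin.lastCases with
      | last => simpa [hl] using hbc
      | cast i => simpa [← Fin.castSucc_succ] using hs i

/-- Let `Φ` be a finite reduced crystallographic root system spanning a
finite-dimensional real inner product space `V`, with Weyl group `W` and base of simple
roots `Δ`.  Writing `n(α,β) = 2⟨α,β⟩/⟨β,β⟩`, two simple roots `α, β ∈ Δ` lie in the same
`W`-orbit if and only if they are joined in the Dynkin diagram by a chain of simple roots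
consecutively linked by a single edge, i.e. with `n(γᵢ, γᵢ₊₁)·n(γᵢ₊₁, γᵢ) = 1`. -/
theorem simple_roots_conjugate_iff_single_edge_chain
    {V : Type*} [NormedAddCommGroup V] [InnerProductSpace ℝ V] [FiniteDimensional ℝ V]
    (Φ : Set V) (hΦfin : Φ.Finite) (hΦ0 : (0 : V) ∉ Φ)
    (hΦspan : Submodule.span ℝ Φ = ⊤)
    (s : V → (V ≃ₗᵢ[ℝ] V))
    (hs : ∀ α ∈ Φ, ∀ x : V, s α x = x - (2 * ⟪α, x⟫ / ⟪α, α⟫) • α)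
    (hΦrefl : ∀ α ∈ Φ, ∀ β ∈ Φ, s α β ∈ Φ)
    (hred : ∀ α ∈ Φ, ∀ t : ℝ, t • α ∈ Φ → t = 1 ∨ t = -1)
    -- crystallographic
    (hcrys : ∀ α ∈ Φ, ∀ β ∈ Φ, ∃ k : ℤ, 2 * ⟪α, β⟫ / ⟪β, β⟫ = (k : ℝ))
    (W : Subgroup (V ≃ₗᵢ[ℝ] V)) (hW : W = Subgroup.closure (s '' Φ))
    (Δ : Set V) (hΔΦ : Δ ⊆ Φ)
    (hΔind : LinearIndependent ℝ (fun a : Δ => (a : V)))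
    (hΔbase : ∀ β ∈ Φ, ∃ c : V → ℝ, Function.support c ⊆ Δ ∧
      β = ∑ᶠ α, c α • α ∧ ((∀ α, 0 ≤ c α) ∨ (∀ α, c α ≤ 0))) :
    ∀ α ∈ Δ, ∀ β ∈ Δ,
      ((∃ w ∈ W, w α = β) ↔
        ∃ (m : ℕ) (γ : Fin (m + 1) → V),
          (∀ i, γ i ∈ Δ) ∧ γ 0 = α ∧ γ (Fin.last m) = β ∧
          ∀ i : Fin m,
            (2 * ⟪γ i.castSucc, γ i.succ⟫ / ⟪γ i.succ, γ i.succ⟫) *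
              (2 * ⟪γ i.succ, γ i.castSucc⟫ / ⟪γ i.castSucc, γ i.castSucc⟫) = 1) := by
  have hΔfin : Δ.Finite := hΦfin.subset hΔΦ
  have := hΔfin.fintype
  have hsum : ∀ c : V → ℝ, Function.support c ⊆ Δ →
      ∑ᶠ α, c α • α = ∑ a : Δ, c a • (a : V) := by
    intro c hc
    rw [← finsum_eq_sum_of_fintype, finsum_set_coe_eq_finsum_mem (f := fun v => c v • v),
      finsum_mem_def, Set.indicator_eq_self.2]
    exact (Function.support_smul_subset_left c id).trans hc
  have hΔspan : ⊤ ≤ Submodule.span ℝ (Set.range fun a : Δ => (a : V)) := by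
    rw [← hΦspan, Submodule.span_le]
    intro β hβ
    obtain ⟨c, hc, hβc, -⟩ := hΔbase β hβ
    rw [hβc, hsum c hc]
    exact Submodule.sum_mem _ fun a _ =>
      Submodule.smul_mem _ _ (Submodule.subset_span ⟨a, rfl⟩)
  let b := Module.Basis.mk hΔind hΔspan
  have hb : ∀ a : Δ, b a = a := fun a => Module.Basis.mk_apply hΔind hΔspan a
  have hrepr : ∀ c : V → ℝ, ∀ a : Δ, b.repr (∑ a : Δ, c a • (a : V)) a = c a := by
    intro c a
    simpa only [hb] using congrFun (b.repr_sum_self fun a : Δ => c a) a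
  let R : BasedRootSystem Δ V :=
    { Φ, s, b
      finite := hΦfin
      zero_notMem := hΦ0
      s_apply := hs
      s_mem := hΦrefl
      reduced := hred
      integral := hcrys
      b_mem := fun i => by rw [hb]; exact hΔΦ i.2
      sign := by
        intro β hβ
        obtain ⟨c, hc, hβc, hsign⟩ := hΔbase β hβ
        rw [hβc, hsum c hc]
        simp only [hrepr]
        exact hsign.imp (fun h i => h i) (fun h i => h i) }
  intro α hα β hβ
  constructor
  · rintro ⟨w, hw, hwα⟩
    have hw' : w ∈ Subgroup.closure (Set.range fun i => R.s (R.b i)) := by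
      refine (Subgroup.closure_le _).2 ?_ (hW ▸ hw)
      rintro _ ⟨γ, hγ, rfl⟩
      exact BasedRootSystem.s_mem_closure (R := R) hγ
    obtain ⟨l, rfl⟩ := BasedRootSystem.exists_word_of_mem_closure hw'
    have hchain := BasedRootSystem.reflTransGen_of_wordProd_apply (R := R) l ⟨α, hα⟩ ⟨β, hβ⟩
      (by simpa only [R, hb] using hwα)
    obtain ⟨m, γ, h0, hm, hγ⟩ := hchain.exists_fin_chain
    refine ⟨m, fun i => γ i, fun i => (γ i).2, congrArg _ h0, congrArg _ hm, fun i => ?_⟩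
    simpa only [R, hb, BasedRootSystem.SingleEdge] using hγ i
  · rintro ⟨m, γ, hγΔ, rfl, rfl, hγ⟩
    suffices ∀ i, ∃ w ∈ W, w (γ 0) = γ i from this _
    intro i
    induction i using Fin.induction with
    | zero => exact ⟨1, one_mem _, rfl⟩
    | succ i ih =>
      obtain ⟨w, hw, hwi⟩ := ih
      obtain ⟨v, hv, hvi⟩ := BasedRootSystem.exists_apply_eq_of_singleEdge (R := R)
        (hΔΦ (hγΔ i.castSucc)) (hΔΦ (hγΔ i.succ)) (hγ i)
      refine ⟨v * w, mul_mem (hW ▸ hv) hw, ?_⟩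
      rw [BasedRootSystem.isometry_mul_apply, hwi, hvi]
end

section
/- Let Φ be a finite root system spanning a finite-dimensional real inner product space V, with Weyl group W, base of simple roots Δ, and closed dominant Weyl chamber C = {x ∈ V : ⟨α, x⟩ ≥ 0 for all α ∈ Δ}. Let τ ∈ C be a unit vector, and let σ be a connected component of the set {x ∈ C : ‖x‖ = 1 and ⟨w·τ, x⟩ ≠ 0 for all w ∈ W} (the unit sphere of the chamber with the hyperplanes (w·τ)^⊥ removed). Define Θ(σ) = {α ∈ Δ : ⟨α, x⟩ ≠ 0 for every x ∈ σ}. Then Θ(σ) is nonempty, and there exists τ_0 ∈ σ such that for every α ∈ Δ one has ⟨α, τ_0⟩ ≠ 0 if and only if α ∈ Θ(σ). -/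
open scoped RealInnerProductSpace

section Auxiliary

variable {V : Type*} [NormedAddCommGroup V] [InnerProductSpace ℝ V]

/-- For linearly independent vectors, a linear combination with coefficients of one sign which
equals `β - k • α` forces `k ≤ 0`. -/
theorem nonpos_of_sub_smul_eq_sum {F : Finset V} (hF : LinearIndepOn ℝ id (F : Set V))
    {α β : V} (hα : α ∈ F) (hβ : β ∈ F) (hne : α ≠ β) {k : ℝ} {c : V → ℝ}
    (h : β - k • α = ∑ v ∈ F, c v • v) (hc : (∀ v, 0 ≤ c v) ∨ (∀ v, c v ≤ 0)) : k ≤ 0 := by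
  classical
  have hsum : ∑ v ∈ F, (c v - (if v = β then 1 else 0) + (if v = α then k else 0)) • id v = 0 := by
    simp only [add_smul, sub_smul, Finset.sum_add_distrib, Finset.sum_sub_distrib, ite_smul,
      zero_smul, one_smul, Finset.sum_ite_eq', hα, hβ, if_true, id, ← h]
    abel
  have key := linearIndepOn_finset_iff.1 hF _ hsum
  have h1 := key α hα
  have h2 := key β hβ
  simp only [hne, hne.symm, if_true, if_false] at h1 h2
  rcases hc with hc | hc
  · linarith [hc α]
  · linarith [hc β]

/-- If the vectors of `T` are linearly independent and pairwise at obtuse angles, a combination of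
them having nonnegative inner product with each of them has nonnegative coefficients. -/
theorem coeff_nonneg_of_inner_sum_nonneg {T : Finset V} (hT : LinearIndepOn ℝ id (T : Set V))
    (hobt : ∀ α ∈ T, ∀ β ∈ T, α ≠ β → ⟪α, β⟫ ≤ 0) {c : V → ℝ}
    (hc : ∀ β ∈ T, 0 ≤ ⟪β, ∑ α ∈ T, c α • α⟫) : ∀ α ∈ T, 0 ≤ c α := by
  set p : V := ∑ α ∈ T, (c α)⁺ • α with hp
  set n : V := ∑ α ∈ T, (c α)⁻ • α with hn
  have hpn : ∑ α ∈ T, c α • α = p - n := by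
    rw [hp, hn, ← Finset.sum_sub_distrib]
    refine Finset.sum_congr rfl fun α _ => ?_
    rw [← sub_smul, posPart_sub_negPart]
  have h1 : 0 ≤ ⟪n, p - n⟫ := by
    rw [← hpn, hn, sum_inner]
    refine Finset.sum_nonneg fun α hα => ?_
    rw [real_inner_smul_left]
    exact mul_nonneg (negPart_nonneg _) (hc α hα)
  have h2 : ⟪n, p⟫ ≤ 0 := by
    rw [hn, hp, sum_inner]
    refine Finset.sum_nonpos fun α hα => ?_
    rw [inner_sum]
    refine Finset.sum_nonpos fun β hβ => ?_
    rw [real_inner_smul_left, real_inner_smul_right, ← mul_assoc]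
    by_cases h : α = β
    · subst h
      rcases le_total 0 (c α) with h0 | h0
      · simp [negPart_eq_zero.2 h0]
      · simp [posPart_eq_zero.2 h0]
    · exact mul_nonpos_of_nonneg_of_nonpos
        (mul_nonneg (negPart_nonneg _) (posPart_nonneg _)) (hobt α hα β hβ h)
  have h3 : n = 0 := by
    rw [inner_sub_right] at h1
    exact inner_self_eq_zero.1 (le_antisymm (by linarith) real_inner_self_nonneg : ⟪n, n⟫ = 0)
  intro α hα
  exact negPart_eq_zero.1 (linearIndepOn_finset_iff.1 hT _ h3 α hα)

/-- Two unit vectors of a convex cone cut out by weak inequalities from `Δ` which lie strictly on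
the same side of every hyperplane orthogonal to an element of `L` lie in the same connected
component of the part of the sphere of the cone that avoids these hyperplanes. -/
theorem mem_connectedComponentIn_sphere_cone (Δ L : Set V) (hL : L.Nonempty) {y z : V}
    (hy : y ∈ {v : V | (∀ α ∈ Δ, 0 ≤ ⟪α, v⟫) ∧ ‖v‖ = 1 ∧ ∀ l ∈ L, ⟪l, v⟫ ≠ 0})
    (hz : z ∈ {v : V | (∀ α ∈ Δ, 0 ≤ ⟪α, v⟫) ∧ ‖v‖ = 1 ∧ ∀ l ∈ L, ⟪l, v⟫ ≠ 0})
    (hyz : ∀ l ∈ L, (0 < ⟪l, y⟫ ↔ 0 < ⟪l, z⟫)) :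
    z ∈ connectedComponentIn
      {v : V | (∀ α ∈ Δ, 0 ≤ ⟪α, v⟫) ∧ ‖v‖ = 1 ∧ ∀ l ∈ L, ⟪l, v⟫ ≠ 0} y := by
  obtain ⟨l₀, hl₀⟩ := hL
  let p : ℝ → V := fun t => (1 - t) • y + t • z
  have hp : ∀ t ∈ Set.Icc (0 : ℝ) 1, ∀ l ∈ L, ⟪l, p t⟫ ≠ 0 := by
    rintro t ⟨ht0, ht1⟩ l hl
    simp only [p, inner_add_right, real_inner_smul_right]
    have hyl := hy.2.2 l hl
    have hzl := hz.2.2 l hl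
    have hl' := hyz l hl
    rcases lt_or_gt_of_ne hyl with h1 | h1
    · have h2 : ⟪l, z⟫ < 0 :=
        lt_of_le_of_ne (not_lt.1 fun h => absurd (hl'.2 h) (not_lt.2 h1.le)) hzl
      have : 0 < (1 - t) * -⟪l, y⟫ + t * -⟪l, z⟫ := by
        rcases ht0.eq_or_lt with rfl | h
        · linarith
        · exact add_pos_of_nonneg_of_pos (mul_nonneg (by linarith) (by linarith))
            (mul_pos h (by linarith))
      intro h
      linarith
    · have h2 := hl'.1 h1
      have : 0 < (1 - t) * ⟪l, y⟫ + t * ⟪l, z⟫ := by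
        rcases ht0.eq_or_lt with rfl | h
        · linarith
        · exact add_pos_of_nonneg_of_pos (mul_nonneg (by linarith) h1.le) (mul_pos h h2)
      exact this.ne'
  have hp0 : ∀ t ∈ Set.Icc (0 : ℝ) 1, ‖p t‖ ≠ 0 := fun t ht h =>
    hp t ht l₀ hl₀ (by rw [norm_eq_zero.1 h, inner_zero_right])
  have hcont : ContinuousOn (fun t => ‖p t‖⁻¹ • p t) (Set.Icc (0 : ℝ) 1) := by
    have hpc : Continuous p := by fun_prop
    exact (hpc.norm.continuousOn.inv₀ hp0).smul hpc.continuousOn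
  have hpre := isPreconnected_Icc.image _ hcont
  refine hpre.subset_connectedComponentIn ⟨0, by simp, ?_⟩ ?_ ⟨1, by simp, ?_⟩
  · simp [p, hy.2.1]
  · rintro _ ⟨t, ht, rfl⟩
    have hpos : 0 < ‖p t‖ := lt_of_le_of_ne (norm_nonneg _) (hp0 t ht).symm
    refine ⟨fun α hα => ?_, ?_, fun l hl => ?_⟩
    · simp only [p, inner_add_right, real_inner_smul_right]
      exact mul_nonneg (inv_nonneg.2 hpos.le) (add_nonneg
        (mul_nonneg (by linarith [ht.2]) (hy.1 α hα)) (mul_nonneg ht.1 (hz.1 α hα)))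
    · rw [norm_smul, norm_inv, norm_norm, inv_mul_cancel₀ hpos.ne']
    · rw [real_inner_smul_right]
      exact mul_ne_zero (inv_ne_zero hpos.ne') (hp t ht l hl)
  · simp [p, hz.2.1]

/-- A continuous function without zeros on a preconnected set has constant sign. -/
theorem IsPreconnected.pos_iff_pos {X : Type*} [TopologicalSpace X] {S : Set X}
    (hS : IsPreconnected S) {f : X → ℝ} (hf : ContinuousOn f S) (h0 : ∀ x ∈ S, f x ≠ 0)
    {x y : X} (hx : x ∈ S) (hy : y ∈ S) : 0 < f x ↔ 0 < f y := by
  have aux : ∀ {x y : X}, x ∈ S → y ∈ S → 0 < f x → 0 < f y := by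
    intro x y hx hy h
    by_contra hneg
    obtain ⟨w, hw, hw0⟩ := hS.intermediate_value hy hx hf ⟨not_lt.1 hneg, h.le⟩
    exact h0 w hw hw0
  exact ⟨aux hx hy, aux hy hx⟩

/-- A group of linear isometries preserving a finite spanning set is finite. -/
theorem finite_of_preserves_finite_spanning {Φ : Set V} (hfin : Φ.Finite)
    (hspan : Submodule.span ℝ Φ = ⊤) (H : Subgroup (V ≃ₗᵢ[ℝ] V))
    (hH : ∀ u ∈ H, ∀ β ∈ Φ, u β ∈ Φ) : Finite H := by
  have := hfin.to_subtype
  refine Finite.of_injective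
    (fun (u : H) (β : Φ) => (⟨(u : V ≃ₗᵢ[ℝ] V) β, hH u u.2 β β.2⟩ : Φ)) fun u v huv => ?_
  apply Subtype.ext
  apply LinearIsometryEquiv.toLinearEquiv_injective
  apply LinearEquiv.toLinearMap_injective
  refine LinearMap.ext_on hspan fun β hβ => ?_
  exact congrArg Subtype.val (congrFun huv ⟨β, hβ⟩)

/-- A sum of nonzero reals all having the sign of `a ≠ 0` is nonzero and has the sign of `a`. -/
theorem sum_pos_iff_of_forall_pos_iff {ι : Type*} [Fintype ι] [Nonempty ι] {f : ι → ℝ} {a : ℝ}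
    (ha : a ≠ 0) (hf0 : ∀ i, f i ≠ 0) (hf : ∀ i, 0 < a ↔ 0 < f i) :
    ∑ i, f i ≠ 0 ∧ (0 < a ↔ 0 < ∑ i, f i) := by
  rcases lt_or_gt_of_ne ha with h | h
  · have : ∑ i, f i < 0 := Finset.sum_neg (fun i _ => lt_of_le_of_ne
      (not_lt.1 fun hi => absurd ((hf i).2 hi) h.not_gt) (hf0 i)) Finset.univ_nonempty
    exact ⟨this.ne, iff_of_false h.not_gt this.not_gt⟩
  · have : 0 < ∑ i, f i := Finset.sum_pos (fun i _ => (hf i).1 h) Finset.univ_nonempty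
    exact ⟨this.ne', iff_of_true h this⟩

end Auxiliary

/-- Let `Φ` be a finite root system spanning a finite-dimensional real
inner product space `V`, with Weyl group `W`, base of simple roots `Δ` and closed
dominant Weyl chamber `C = {x : ∀ α ∈ Δ, ⟨α, x⟩ ≥ 0}`.  Let `τ ∈ C` be a unit vector
and let `σS` be a connected component of the set
`{x ∈ C : ‖x‖ = 1 ∧ ∀ w ∈ W, ⟨w·τ, x⟩ ≠ 0}`.  Then the set
`Θ(σS) = {α ∈ Δ : ∀ x ∈ σS, ⟨α, x⟩ ≠ 0}` is nonempty, and there exists `τ₀ ∈ σS`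
such that for every `α ∈ Δ`, `⟨α, τ₀⟩ ≠ 0 ↔ α ∈ Θ(σS)`. -/
theorem connected_component_of_chamber_roots
    {V : Type*} [NormedAddCommGroup V] [InnerProductSpace ℝ V] [FiniteDimensional ℝ V]
    (Φ : Set V) (hΦfin : Φ.Finite) (hΦ0 : (0 : V) ∉ Φ)
    (hΦspan : Submodule.span ℝ Φ = ⊤)
    (s : V → (V ≃ₗᵢ[ℝ] V))
    (hs : ∀ α ∈ Φ, ∀ x : V, s α x = x - (2 * ⟪α, x⟫ / ⟪α, α⟫) • α)
    (hΦrefl : ∀ α ∈ Φ, ∀ β ∈ Φ, s α β ∈ Φ)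
    (W : Subgroup (V ≃ₗᵢ[ℝ] V)) (hW : W = Subgroup.closure (s '' Φ))
    (Δ : Set V) (hΔΦ : Δ ⊆ Φ)
    (hΔind : LinearIndependent ℝ (fun a : Δ => (a : V)))
    (hΔbase : ∀ β ∈ Φ, ∃ c : V → ℝ, Function.support c ⊆ Δ ∧
      β = ∑ᶠ α, c α • α ∧ ((∀ α, 0 ≤ c α) ∨ (∀ α, c α ≤ 0)))
    (τ : V) (hτnorm : ‖τ‖ = 1) (hτC : ∀ α ∈ Δ, 0 ≤ ⟪α, τ⟫)
    (σS : Set V)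
    (hσS : ∃ x ∈ {y : V | (∀ α ∈ Δ, 0 ≤ ⟪α, y⟫) ∧ ‖y‖ = 1 ∧ ∀ w ∈ W, ⟪w τ, y⟫ ≠ 0},
      σS = connectedComponentIn
        {y : V | (∀ α ∈ Δ, 0 ≤ ⟪α, y⟫) ∧ ‖y‖ = 1 ∧ ∀ w ∈ W, ⟪w τ, y⟫ ≠ 0} x) :
    {α ∈ Δ | ∀ x ∈ σS, ⟪α, x⟫ ≠ 0}.Nonempty ∧
    ∃ τ₀ ∈ σS, ∀ α ∈ Δ, (⟪α, τ₀⟫ ≠ 0 ↔ ∀ x ∈ σS, ⟪α, x⟫ ≠ 0) := by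
  classical
  obtain ⟨x₀, hx₀, rfl⟩ := hσS
  set A : Set V := {y : V | (∀ α ∈ Δ, 0 ≤ ⟪α, y⟫) ∧ ‖y‖ = 1 ∧ ∀ w ∈ W, ⟪w τ, y⟫ ≠ 0} with hA
  set σ := connectedComponentIn A x₀ with hσ
  have hσA : σ ⊆ A := connectedComponentIn_subset A x₀
  have hyσ : x₀ ∈ σ := mem_connectedComponentIn hx₀
  have hsW : ∀ α ∈ Δ, s α ∈ W := fun α hα =>
    hW ▸ Subgroup.subset_closure ⟨α, hΔΦ hα, rfl⟩
  have hsself : ∀ α ∈ Φ, ∀ v : V, ⟪α, v⟫ = 0 → s α v = v := fun α hα v hv => by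
    rw [hs α hα, hv]; simp
  have hself : ∀ α ∈ Φ, 0 < ⟪α, α⟫ := fun α hα =>
    real_inner_self_pos.2 fun h => hΦ0 (h ▸ hα)
  have hΔfin : Δ.Finite := hΦfin.subset hΔΦ
  set F : Finset V := hΔfin.toFinset with hF
  have hFΔ : (F : Set V) = Δ := hΔfin.coe_toFinset
  have hmemF : ∀ v, v ∈ F ↔ v ∈ Δ := fun v => hΔfin.mem_toFinset
  have hFind : LinearIndepOn ℝ id (F : Set V) := by rw [hFΔ]; exact hΔind
  have hexp : ∀ β ∈ Φ, ∃ c : V → ℝ, β = ∑ v ∈ F, c v • v ∧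
      ((∀ α, 0 ≤ c α) ∨ (∀ α, c α ≤ 0)) := by
    intro β hβ
    obtain ⟨c, hcs, hc, hsgn⟩ := hΔbase β hβ
    refine ⟨c, ?_, hsgn⟩
    rw [hc]
    refine finsum_eq_sum_of_support_subset _ fun v hv => ?_
    rw [hFΔ]
    exact hcs fun h0 => hv (by simp [h0])
  have hobt : ∀ α ∈ Δ, ∀ β ∈ Δ, α ≠ β → ⟪α, β⟫ ≤ 0 := by
    intro α hα β hβ hne
    obtain ⟨c, hc, hsgn⟩ := hexp _ (hΦrefl α (hΔΦ hα) β (hΔΦ hβ))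
    rw [hs α (hΔΦ hα)] at hc
    have h := nonpos_of_sub_smul_eq_sum hFind ((hmemF α).2 hα) ((hmemF β).2 hβ) hne hc hsgn
    by_contra hpos
    have := div_pos (mul_pos two_pos (not_le.1 hpos)) (hself α (hΔΦ hα))
    linarith
  have hsign : ∀ w ∈ W, ∀ x ∈ σ, ∀ y ∈ σ, (0 < ⟪w τ, x⟫ ↔ 0 < ⟪w τ, y⟫) :=
    fun w hw x hx y hy => IsPreconnected.pos_iff_pos isPreconnected_connectedComponentIn
      (f := fun v => ⟪w τ, v⟫) (by fun_prop) (fun v hv => (hσA hv).2.2 w hw) hx hy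
  set T : Finset V := F.filter fun α => ∃ x ∈ σ, ⟪α, x⟫ = 0 with hT
  have hTΔ : ∀ α ∈ T, α ∈ Δ := fun α hα => (hmemF α).1 (Finset.mem_filter.1 hα).1
  set H : Subgroup (V ≃ₗᵢ[ℝ] V) := Subgroup.closure (s '' (T : Set V)) with hH
  have hHW : H ≤ W := (Subgroup.closure_le W).2 (by
    rintro _ ⟨α, hα, rfl⟩
    exact hsW α (hTΔ α hα))
  have hWΦ : ∀ u ∈ W, ∀ β ∈ Φ, u β ∈ Φ := by
    have key : ∀ u ∈ W, ∀ β, u β ∈ Φ ↔ β ∈ Φ := by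
      intro u hu
      rw [hW] at hu
      induction hu using Subgroup.closure_induction with
      | mem u hu =>
        obtain ⟨α, hα, rfl⟩ := hu
        refine fun β => ⟨fun h => ?_, hΦrefl α hα β⟩
        have h2 : s α (s α β) = β := by
          have := (hself α hα).ne'
          rw [hs α hα (s α β), hs α hα β, inner_sub_right, real_inner_smul_right, sub_sub,
            ← add_smul, sub_eq_self]
          convert zero_smul ℝ α using 2
          field_simp
          ring
        exact h2 ▸ hΦrefl α hα _ h
      | one => exact fun β => Iff.rfl
      | mul u v _ _ hu hv => exact fun β => (hu (v β)).trans (hv β)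
      | inv u _ hu =>
        intro β
        have := hu (u⁻¹ β)
        rw [show u (u⁻¹ β) = β from u.apply_symm_apply β] at this
        exact this.symm
    exact fun u hu β hβ => (key u hu β).2 hβ
  have : Finite H := finite_of_preserves_finite_spanning hΦfin hΦspan H
    fun u hu => hWΦ u (hHW hu)
  have := Fintype.ofFinite H
  have hHsign : ∀ u ∈ H, ∀ w ∈ W, (0 < ⟪w τ, x₀⟫ ↔ 0 < ⟪(u * w) τ, x₀⟫) := by
    intro u hu
    induction hu using Subgroup.closure_induction with
    | mem u hu =>
      obtain ⟨α, hα, rfl⟩ := hu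
      intro w hw
      have hαΔ := hTΔ α hα
      obtain ⟨x, hx, hαx⟩ := (Finset.mem_filter.1 hα).2
      rw [hsign w hw x₀ hyσ x hx, hsign _ (W.mul_mem (hsW α hαΔ) hw) x₀ hyσ x hx]
      have : ⟪(s α * w) τ, x⟫ = ⟪w τ, x⟫ := by
        conv_lhs => rw [← hsself α (hΔΦ hαΔ) x hαx]
        exact (s α).inner_map_map (w τ) x
      rw [this]
    | one => exact fun w _ => by rw [one_mul]
    | mul u v _ hv' hu hv =>
      intro w hw
      rw [mul_assoc]
      exact (hv w hw).trans (hu _ (W.mul_mem (hHW hv') hw))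
    | inv u hu' hu =>
      intro w hw
      have := hu _ (W.mul_mem (W.inv_mem (hHW hu')) hw)
      rw [mul_inv_cancel_left] at this
      exact this.symm
  have hHspan : ∀ u ∈ H, ∀ v : V, v - u v ∈ Submodule.span ℝ (T : Set V) := by
    intro u hu
    induction hu using Subgroup.closure_induction with
    | mem u hu =>
      obtain ⟨α, hα, rfl⟩ := hu
      intro v
      rw [hs α (hΔΦ (hTΔ α hα)), sub_sub_cancel]
      exact Submodule.smul_mem _ _ (Submodule.subset_span hα)
    | one => exact fun v => by simp
    | mul u v _ _ hu hv =>
      intro x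
      have := Submodule.add_mem _ (hv x) (hu (v x))
      rwa [sub_add_sub_cancel] at this
    | inv u _ hu =>
      intro x
      have := Submodule.neg_mem _ (hu (u⁻¹ x))
      rwa [show u (u⁻¹ x) = x from u.apply_symm_apply x, neg_sub] at this
  set z : V := ∑ u : H, (u : V ≃ₗᵢ[ℝ] V) x₀ with hz
  set N : ℝ := ((Fintype.card H : ℕ) : ℝ) with hN
  have hNpos : 0 < N := by rw [hN]; exact_mod_cast Fintype.card_pos
  have hzsign : ∀ w ∈ W, ⟪w τ, z⟫ ≠ 0 ∧ (0 < ⟪w τ, x₀⟫ ↔ 0 < ⟪w τ, z⟫) := by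
    intro w hw
    rw [hz, inner_sum]
    have hinv : ∀ u : H, ⟪w τ, (u : V ≃ₗᵢ[ℝ] V) x₀⟫ =
        ⟪((u : V ≃ₗᵢ[ℝ] V)⁻¹ * w) τ, x₀⟫ := fun u => by
      rw [← (u : V ≃ₗᵢ[ℝ] V).inner_map_map (((u : V ≃ₗᵢ[ℝ] V)⁻¹ * w) τ) x₀]
      congr 1
      exact ((u : V ≃ₗᵢ[ℝ] V).apply_symm_apply (w τ)).symm
    refine sum_pos_iff_of_forall_pos_iff (hx₀.2.2 w hw) (fun u => ?_) fun u => ?_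
    · rw [hinv]
      exact hx₀.2.2 _ (W.mul_mem (W.inv_mem (hHW u.2)) hw)
    · rw [hinv]
      exact hHsign _ (H.inv_mem u.2) w hw
  have hzT : ∀ β ∈ T, ⟪β, z⟫ = 0 := by
    intro β hβ
    have hβΦ := hΔΦ (hTΔ β hβ)
    have hfix : s β z = z := by
      rw [hz, map_sum]
      exact Fintype.sum_equiv (Equiv.mulLeft (⟨s β, Subgroup.subset_closure ⟨β, hβ, rfl⟩⟩ : H))
        _ _ fun u => rfl
    rw [hs β hβΦ, sub_eq_self, smul_eq_zero] at hfix
    rcases hfix with h | h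
    · have := (hself β hβΦ).ne'
      field_simp at h
      linarith
    · exact absurd (h ▸ hβΦ) hΦ0
  obtain ⟨c, hc⟩ : ∃ c : V → ℝ, N • x₀ - z = ∑ α ∈ T, c α • α := by
    have hmem : N • x₀ - z ∈ Submodule.span ℝ (T : Set V) := by
      have : N • x₀ - z = ∑ u : H, (x₀ - (u : V ≃ₗᵢ[ℝ] V) x₀) := by
        rw [Finset.sum_sub_distrib, Finset.sum_const, Finset.card_univ, hN, hz,
          Nat.cast_smul_eq_nsmul]
      rw [this]
      exact Submodule.sum_mem _ fun u _ => hHspan u u.2 x₀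
    obtain ⟨c, -, hc⟩ := Submodule.mem_span_finset.1 hmem
    exact ⟨c, hc.symm⟩
  have hc0 : ∀ α ∈ T, 0 ≤ c α := by
    refine coeff_nonneg_of_inner_sum_nonneg
      (hFind.mono (Finset.coe_subset.2 (Finset.filter_subset _ _)))
      (fun α hα β hβ => hobt α (hTΔ α hα) β (hTΔ β hβ)) fun β hβ => ?_
    rw [← hc, inner_sub_right, real_inner_smul_right, hzT β hβ, sub_zero]
    exact mul_nonneg hNpos.le (hx₀.1 β (hTΔ β hβ))
  have hzpos : ∀ β ∈ Δ, β ∉ T → 0 < ⟪β, z⟫ := by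
    intro β hβ hβT
    have hβx : 0 < ⟪β, x₀⟫ := lt_of_le_of_ne (hx₀.1 β hβ) fun h =>
      hβT (Finset.mem_filter.2 ⟨(hmemF β).2 hβ, x₀, hyσ, h.symm⟩)
    have h1 : ⟪β, N • x₀ - z⟫ ≤ 0 := by
      rw [hc, inner_sum]
      refine Finset.sum_nonpos fun α hα => ?_
      rw [real_inner_smul_right]
      exact mul_nonpos_of_nonneg_of_nonpos (hc0 α hα)
        (hobt β hβ α (hTΔ α hα) fun h => hβT (h ▸ hα))
    rw [inner_sub_right, real_inner_smul_right] at h1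
    linarith [mul_pos hNpos hβx]
  have hz0 : 0 < ‖z‖ := norm_pos_iff.2 fun h =>
    (hzsign 1 W.one_mem).1 (by rw [h, inner_zero_right])
  have hzinv : 0 < ‖z‖⁻¹ := inv_pos.2 hz0
  have hτ₀A : ‖z‖⁻¹ • z ∈ A := by
    refine ⟨fun α hα => ?_, ?_, fun w hw => ?_⟩
    · rw [real_inner_smul_right]
      refine mul_nonneg hzinv.le ?_
      by_cases h : α ∈ T
      · exact (hzT α h).ge
      · exact (hzpos α hα h).le
    · rw [norm_smul, norm_inv, norm_norm, inv_mul_cancel₀ hz0.ne']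
    · rw [real_inner_smul_right]
      exact mul_ne_zero hzinv.ne' (hzsign w hw).1
  have hAL : A = {v : V | (∀ α ∈ Δ, 0 ≤ ⟪α, v⟫) ∧ ‖v‖ = 1 ∧
      ∀ l ∈ (fun w : V ≃ₗᵢ[ℝ] V => w τ) '' (W : Set (V ≃ₗᵢ[ℝ] V)), ⟪l, v⟫ ≠ 0} := by
    simp [hA]
  have hτ₀σ : ‖z‖⁻¹ • z ∈ σ := by
    rw [hσ, hAL]
    refine mem_connectedComponentIn_sphere_cone Δ _ (Set.Nonempty.image _ ⟨1, W.one_mem⟩)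
      (hAL ▸ hx₀) (hAL ▸ hτ₀A) ?_
    rintro _ ⟨w, hw, rfl⟩
    simp only [real_inner_smul_right]
    rw [(hzsign w hw).2, mul_pos_iff_of_pos_left hzinv]
  have hτ₀ : ∀ α ∈ Δ, (⟪α, ‖z‖⁻¹ • z⟫ ≠ 0 ↔ ∀ x ∈ σ, ⟪α, x⟫ ≠ 0) := by
    intro α hα
    refine ⟨fun h x hx hαx => h ?_, fun h => h _ hτ₀σ⟩
    rw [real_inner_smul_right,
      hzT α (Finset.mem_filter.2 ⟨(hmemF α).2 hα, x, hx, hαx⟩), mul_zero]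
  refine ⟨?_, _, hτ₀σ, hτ₀⟩
  by_contra hempty
  have hΔz : ∀ α ∈ Δ, ⟪α, z⟫ = 0 := by
    intro α hα
    by_contra h
    exact hempty ⟨α, hα, (hτ₀ α hα).1 (by
      rw [real_inner_smul_right]; exact mul_ne_zero hzinv.ne' h)⟩
  have hΦz : ∀ β ∈ Φ, ⟪z, β⟫ = 0 := by
    intro β hβ
    obtain ⟨c, hc, -⟩ := hexp β hβ
    rw [hc, inner_sum]
    refine Finset.sum_eq_zero fun α hα => ?_
    rw [real_inner_smul_right, real_inner_comm, hΔz α ((hmemF α).1 hα), mul_zero]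
  have hzz : z ∈ Submodule.span ℝ Φ := hΦspan ▸ Submodule.mem_top
  have : ⟪z, z⟫ = 0 := by
    have hle : Submodule.span ℝ Φ ≤ LinearMap.ker (innerₛₗ ℝ z) :=
      Submodule.span_le.2 fun β hβ => hΦz β hβ
    exact hle hzz
  exact hz0.ne' (norm_eq_zero.2 (inner_self_eq_zero.1 this))
end

section
/- Let V be a finite-dimensional real vector space, and let q_1, q_2, q_1', q_2' be nondegenerate symmetric bilinear forms on V with q_1' = a q_1 + b q_2 and q_2' = c q_1 + d q_2 for real numbers a, b, c, d. Let A be the unique endomorphism of V with q_1(x, y) = q_2(A x, y) for all x, y ∈ V, and let B be the unique endomorphism with q_1'(x, y) = q_2'(B x, y) for all x, y ∈ V. Then c·A + d·id_V is invertible and B = (a·A + b·id_V) ∘ (c·A + d·id_V)^{-1}. -/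
/-- Change of basis for the endomorphism associated to a pair of
nondegenerate symmetric bilinear forms: if `q₁' = a q₁ + b q₂`, `q₂' = c q₁ + d q₂`
are all nondegenerate, `A` satisfies `q₁(x,y) = q₂(Ax,y)` and `B` satisfies
`q₁'(x,y) = q₂'(Bx,y)`, then `c·A + d·id` is invertible and
`B = (a·A + b·id) ∘ (c·A + d·id)⁻¹`, i.e. `B ∘ (c·A + d·id) = a·A + b·id`. -/
theorem pencil_change_of_basis
    {V : Type*} [AddCommGroup V] [Module ℝ V] [FiniteDimensional ℝ V]
    (q₁ q₂ q₁' q₂' : V →ₗ[ℝ] V →ₗ[ℝ] ℝ)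
    (hs₁ : ∀ x y : V, q₁ x y = q₁ y x) (hs₂ : ∀ x y : V, q₂ x y = q₂ y x)
    (hs₁' : ∀ x y : V, q₁' x y = q₁' y x) (hs₂' : ∀ x y : V, q₂' x y = q₂' y x)
    (hnd₁ : ∀ v : V, (∀ w : V, q₁ v w = 0) → v = 0)
    (hnd₂ : ∀ v : V, (∀ w : V, q₂ v w = 0) → v = 0)
    (hnd₁' : ∀ v : V, (∀ w : V, q₁' v w = 0) → v = 0)
    (hnd₂' : ∀ v : V, (∀ w : V, q₂' v w = 0) → v = 0)
    (a b c d : ℝ)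
    (h₁ : q₁' = a • q₁ + b • q₂) (h₂ : q₂' = c • q₁ + d • q₂)
    (A B : Module.End ℝ V)
    (hA : ∀ x y : V, q₁ x y = q₂ (A x) y)
    (hB : ∀ x y : V, q₁' x y = q₂' (B x) y) :
    IsUnit (c • A + d • (1 : Module.End ℝ V)) ∧
    B * (c • A + d • (1 : Module.End ℝ V)) = a • A + b • (1 : Module.End ℝ V) := by
  have hL : ∀ x y : V, q₂ ((c • A + d • (1 : Module.End ℝ V)) x) y = q₂' x y := by
    intro x y
    simp [h₂, hA]
  have hM : ∀ x y : V, q₂ ((a • A + b • (1 : Module.End ℝ V)) x) y = q₁' x y := by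
    intro x y
    simp [h₁, hA]
  have hcomm : Commute (a • A + b • (1 : Module.End ℝ V)) (c • A + d • (1 : Module.End ℝ V)) := by
    have hA1 : Commute A (c • A + d • (1 : Module.End ℝ V)) :=
      ((Commute.refl A).smul_right c).add_right ((Commute.one_right A).smul_right d)
    exact (hA1.smul_left a).add_left ((Commute.one_left _).smul_left b)
  generalize c • A + d • (1 : Module.End ℝ V) = L at *
  generalize a • A + b • (1 : Module.End ℝ V) = M at *
  have hunit : IsUnit L := by
    rw [LinearMap.isUnit_iff_ker_eq_bot, LinearMap.ker_eq_bot']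
    intro x hx
    refine hnd₂' x fun w => ?_
    rw [← hL, hx, map_zero, LinearMap.zero_apply]
  have hLB : L * B = M := by
    ext x
    refine sub_eq_zero.mp (hnd₂ _ fun w => ?_)
    rw [map_sub, LinearMap.sub_apply, Module.End.mul_apply, hL, hM, hB, sub_self]
  refine ⟨hunit, hunit.mul_left_cancel ?_⟩
  rw [← mul_assoc, hLB, hcomm.eq]
end

section
/- Let n ≥ 3 and let q_1, q_2 be quadratic forms on ℝ^n such that for every (a, b) ∈ ℝ² \ {(0,0)} the quadratic form a q_1 + b q_2 is nondegenerate. Then q_1 and q_2 have a common nonzero isotropic vector: there exists v ∈ ℝ^n \ {0} with q_1(v) = 0 and q_2(v) = 0. -/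
namespace QuadraticForm

variable {E : Type*} [NormedAddCommGroup E] [NormedSpace ℝ E]

theorem continuous_of_finiteDimensional [FiniteDimensional ℝ E] (q : QuadraticForm ℝ E) :
    Continuous q := by
  have hB : Continuous fun x => LinearMap.toContinuousLinearMap (q.polarBilin x) :=
    (LinearMap.toContinuousLinearMap.toLinearMap ∘ₗ
      q.polarBilin).continuous_of_finiteDimensional
  have h : Continuous fun x => (1 / 2 : ℝ) * q.polarBilin x x :=
    continuous_const.mul (hB.clm_apply continuous_id)
  convert h using 2 with x
  simp [QuadraticMap.polar_self]

theorem map_smul_add_smul (q : QuadraticForm ℝ E) (a b : ℝ) (u v : E) :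
    q (a • u + b • v) = a ^ 2 * q u + b ^ 2 * q v + a * b * QuadraticMap.polar q u v := by
  rw [QuadraticMap.map_add (⇑q), QuadraticMap.map_smul, QuadraticMap.map_smul,
    QuadraticMap.polar_smul_left, QuadraticMap.polar_smul_right]
  simp only [smul_eq_mul]
  ring

/-- A sign change of `q₂` along a totally isotropic plane of `q₁` yields a common zero. -/
theorem exists_common_isotropic_of_polar_eq_zero [FiniteDimensional ℝ E]
    (q₁ q₂ : QuadraticForm ℝ E) {u v : E} (hu : q₁ u = 0) (hv : q₁ v = 0)
    (huv : QuadraticMap.polar q₁ u v = 0) (hu₂ : 0 < q₂ u) (hv₂ : q₂ v < 0) :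
    ∃ x : E, x ≠ 0 ∧ q₁ x = 0 ∧ q₂ x = 0 := by
  have hc : Continuous fun t : ℝ => q₂ ((1 - t) • u + t • v) :=
    q₂.continuous_of_finiteDimensional.comp (by fun_prop)
  obtain ⟨t, -, ht⟩ := intermediate_value_Icc' zero_le_one hc.continuousOn
    (show (0 : ℝ) ∈ _ by simp [hu₂.le, hv₂.le])
  refine ⟨(1 - t) • u + t • v, fun h0 => ?_, by rw [map_smul_add_smul, hu, hv, huv]; ring, ht⟩
  have h : q₂ ((1 - t) • u) = q₂ (t • v) := by
    rw [eq_neg_of_add_eq_zero_left h0, QuadraticMap.map_neg]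
  rw [QuadraticMap.map_smul, QuadraticMap.map_smul, smul_eq_mul, smul_eq_mul] at h
  rcases eq_or_ne t 0 with rfl | ht0
  · norm_num at h
    exact hu₂.ne' h
  · nlinarith [mul_self_nonneg (1 - t), mul_neg_of_pos_of_neg (mul_self_pos.2 ht0) hv₂,
      mul_nonneg (mul_self_nonneg (1 - t)) hu₂.le]

/-- In dimension at least three, a sign change of `q₂` on the isotropic cone of `q₁` yields a
common zero. -/
theorem exists_common_isotropic_of_sign_change [FiniteDimensional ℝ E]
    (hE : 3 ≤ Module.finrank ℝ E) (q₁ q₂ : QuadraticForm ℝ E) {u v : E}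
    (hu : q₁ u = 0) (hv : q₁ v = 0) (hu₂ : 0 < q₂ u) (hv₂ : q₂ v < 0) :
    ∃ x : E, x ≠ 0 ∧ q₁ x = 0 ∧ q₂ x = 0 := by
  obtain ⟨w, hw, hw0⟩ := (Submodule.ne_bot_iff _).1 <|
    LinearMap.ker_ne_bot_of_finrank_lt (f := (q₁.polarBilin u).prod (q₁.polarBilin v))
      (by rw [Module.finrank_prod, Module.finrank_self]; omega)
  obtain ⟨huw, hvw⟩ : QuadraticMap.polar q₁ u w = 0 ∧ QuadraticMap.polar q₁ v w = 0 := by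
    simpa using hw
  by_cases huv : QuadraticMap.polar q₁ u v = 0
  · exact exists_common_isotropic_of_polar_eq_zero q₁ q₂ hu hv huv hu₂ hv₂
  by_cases hw₁ : q₁ w = 0
  · rcases lt_trichotomy (q₂ w) 0 with h | h | h
    · exact exists_common_isotropic_of_polar_eq_zero q₁ q₂ hu hw₁ huw hu₂ h
    · exact ⟨w, hw0, hw₁, h⟩
    · exact exists_common_isotropic_of_polar_eq_zero q₁ q₂ hw₁ hv
        (by rw [QuadraticMap.polar_comm, hvw]) h hv₂
  wlog hs : QuadraticMap.polar q₁ u v * q₁ w < 0 generalizing v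
  · refine this (v := -v) (by rwa [QuadraticMap.map_neg]) (by rwa [QuadraticMap.map_neg])
      ?_ ?_ ?_ ?_
    · simpa [huw] using hvw
    · rw [QuadraticMap.polar_neg_left, hvw, neg_zero]
    · rwa [QuadraticMap.polar_neg_right, neg_eq_zero]
    · rw [QuadraticMap.polar_neg_right]
      have := (mul_ne_zero huv hw₁).lt_or_gt.resolve_left hs
      linarith
  set β := QuadraticMap.polar q₁ u v
  have hk : 0 ≤ -β / q₁ w := by
    rw [← mul_div_mul_right _ _ hw₁]
    exact div_nonneg (by linarith) (mul_self_nonneg _)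
  set k := √(-β / q₁ w)
  have hk2 : k ^ 2 * q₁ w = -β := by rw [Real.sq_sqrt hk]; field_simp
  have hc : Continuous fun t : ℝ =>
      q₂ (((1 - t) ^ 2 • u + t ^ 2 • v) + (k * t * (1 - t)) • w) :=
    q₂.continuous_of_finiteDimensional.comp (by fun_prop)
  obtain ⟨t, -, ht⟩ := intermediate_value_Icc' zero_le_one hc.continuousOn
    (show (0 : ℝ) ∈ _ by simp [hu₂.le, hv₂.le])
  refine ⟨_, fun h0 => ?_, ?_, ht⟩
  · have h1 : t ^ 2 * β = 0 := by
      have := congrArg (q₁.polarBilin u) h0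
      simpa [QuadraticMap.polar_self, hu, huw] using this
    have h2 : (1 - t) ^ 2 * β = 0 := by
      have := congrArg (q₁.polarBilin v) h0
      simpa [QuadraticMap.polar_self, hv, hvw, QuadraticMap.polar_comm q₁ v u] using this
    have h3 := pow_eq_zero_iff two_ne_zero |>.1 ((mul_eq_zero.1 h1).resolve_right huv)
    have h4 := pow_eq_zero_iff two_ne_zero |>.1 ((mul_eq_zero.1 h2).resolve_right huv)
    linarith
  · rw [QuadraticMap.map_add (⇑q₁), QuadraticMap.polar_add_left, QuadraticMap.polar_smul_left,
      QuadraticMap.polar_smul_left, QuadraticMap.polar_smul_right,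
      QuadraticMap.polar_smul_right, huw, hvw, map_smul_add_smul, hu, hv,
      QuadraticMap.map_smul]
    simp only [smul_eq_mul]
    linear_combination (t * (1 - t)) ^ 2 * hk2

/-- If `q₂` is positive on the isotropic cone of `q₁` and `q₁` takes a positive value, then a
minimizer of `q₂ / q₁` on `{q₁ > 0}` lies in the radical of a member of the pencil. -/
theorem exists_mem_radical_sub_smul [FiniteDimensional ℝ E] (q₁ q₂ : QuadraticForm ℝ E)
    (hpos : ∀ x, x ≠ 0 → q₁ x = 0 → 0 < q₂ x) (hq₁ : ∃ x, 0 < q₁ x) :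
    ∃ (α : ℝ) (x : E), x ≠ 0 ∧ ∀ w, QuadraticMap.polar (q₂ - α • q₁) x w = 0 := by
  have hc₁ := q₁.continuous_of_finiteDimensional
  have hc₂ := q₂.continuous_of_finiteDimensional
  have hnormalize : ∀ y, 0 < q₁ y → ∃ c : ℝ, 0 < c ∧ ‖c • y‖ = 1 := fun y hy => by
    have hy0 : 0 < ‖y‖ := norm_pos_iff.2 fun h => by simp [h] at hy
    exact ⟨‖y‖⁻¹, inv_pos.2 hy0, by rw [norm_smul, norm_inv, norm_norm, inv_mul_cancel₀ hy0.ne']⟩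
  obtain ⟨x₀, hx₀, hx₀n⟩ : ∃ x, 0 < q₁ x ∧ ‖x‖ = 1 := by
    obtain ⟨y, hy⟩ := hq₁
    obtain ⟨c, hc, hn⟩ := hnormalize y hy
    exact ⟨c • y, by rw [QuadraticMap.map_smul, smul_eq_mul]; positivity, hn⟩
  set M := q₂ x₀ / q₁ x₀ with hM
  set K : Set E := Metric.sphere 0 1 ∩ {x | 0 ≤ q₁ x ∧ q₂ x ≤ M * q₁ x}
  have hKc : IsCompact K := (isCompact_sphere 0 1).inter_right
    ((isClosed_le continuous_const hc₁).inter (isClosed_le hc₂ (continuous_const.mul hc₁)))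
  have hx₀K : x₀ ∈ K :=
    ⟨by simpa using hx₀n, hx₀.le, by rw [hM, div_mul_cancel₀ _ hx₀.ne']⟩
  have hne : ∀ x ∈ K, x ≠ 0 := fun x hx h => by
    have := hx.1
    simp [h] at this
  have hKpos : ∀ x ∈ K, 0 < q₁ x := fun x hx => by
    refine lt_of_le_of_ne hx.2.1 fun h => ?_
    have h1 := hpos x (hne x hx) h.symm
    have h2 := hx.2.2
    rw [← h, mul_zero] at h2
    linarith
  obtain ⟨x, hxK, hmin⟩ := hKc.exists_isMinOn ⟨x₀, hx₀K⟩
    (hc₂.continuousOn.div hc₁.continuousOn fun x hx => (hKpos x hx).ne')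
  set α := q₂ x / q₁ x with hα
  have hαx : q₂ x = α * q₁ x := by rw [hα, div_mul_cancel₀ _ (hKpos x hxK).ne']
  have hαM : α ≤ M := hmin hx₀K
  have hle : ∀ y, 0 < q₁ y → α * q₁ y ≤ q₂ y := by
    intro y hy
    obtain ⟨c, hc, hn⟩ := hnormalize y hy
    have h1 : q₁ (c • y) = c * c * q₁ y := QuadraticMap.map_smul _ _ _
    have h2 : q₂ (c • y) = c * c * q₂ y := QuadraticMap.map_smul _ _ _
    have hcy : 0 < q₁ (c • y) := by rw [h1]; positivity
    have key : α * q₁ (c • y) ≤ q₂ (c • y) := by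
      by_cases hyK : q₂ (c • y) ≤ M * q₁ (c • y)
      · exact (le_div_iff₀ hcy).1 (hmin (show c • y ∈ K from ⟨by simpa using hn, hcy.le, hyK⟩))
      · exact (mul_le_mul_of_nonneg_right hαM hcy.le).trans (not_le.1 hyK).le
    rw [h1, h2] at key
    refine le_of_mul_le_mul_left ?_ (mul_pos hc hc)
    linarith
  refine ⟨α, x, hne x hxK, fun w => ?_⟩
  set p := q₂ - α • q₁
  have hpx : ∀ y, p y = q₂ y - α * q₁ y := fun y => rfl
  have hexp : ∀ t : ℝ, p (x + t • w) = t * QuadraticMap.polar p x w + t ^ 2 * p w := fun t => by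
    have := map_smul_add_smul p 1 t x w
    rw [one_smul, hpx x, hαx] at this
    rw [this]
    ring
  have hev : ∀ᶠ t : ℝ in nhds 0, 0 < q₁ (x + t • w) := by
    have : Continuous fun t : ℝ => q₁ (x + t • w) := hc₁.comp (by fun_prop)
    exact this.continuousAt.eventually_const_lt (by simpa using hKpos x hxK)
  have hlocal : IsLocalMin (fun t : ℝ => t * QuadraticMap.polar p x w + t ^ 2 * p w) 0 := by
    filter_upwards [hev] with t ht
    have h : 0 ≤ p (x + t • w) := sub_nonneg.2 (hle _ ht)
    rw [hexp] at h
    simpa using h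
  have hd : HasDerivAt (fun t : ℝ => t * QuadraticMap.polar p x w + t ^ 2 * p w)
      (QuadraticMap.polar p x w) 0 := by
    have h := ((hasDerivAt_id (0 : ℝ)).mul_const (QuadraticMap.polar p x w)).fun_add
      (((hasDerivAt_id (0 : ℝ)).pow 2).mul_const (p w))
    simpa using h
  exact hlocal.hasDerivAt_eq_zero hd

end QuadraticForm


/-- Let `n ≥ 3` and let `q₁, q₂` be quadratic forms on `ℝⁿ` such that
every nonzero linear combination `a q₁ + b q₂` is nondegenerate (its associated symmetric
bilinear form, i.e. half the polar form, is separating). Then `q₁` and `q₂` have a common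
nonzero isotropic vector. -/
theorem regular_pencil_has_common_isotropic_vector
    (n : ℕ) (hn : 3 ≤ n) (q₁ q₂ : QuadraticForm ℝ (Fin n → ℝ))
    (hnd : ∀ a b : ℝ, ¬(a = 0 ∧ b = 0) →
      ∀ v : Fin n → ℝ,
        (∀ w : Fin n → ℝ, QuadraticMap.polar (⇑(a • q₁ + b • q₂)) v w = 0) → v = 0) :
    ∃ v : Fin n → ℝ, v ≠ 0 ∧ q₁ v = 0 ∧ q₂ v = 0 := by
  by_contra! hno
  have hE : 3 ≤ Module.finrank ℝ (Fin n → ℝ) := by simpa using hn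
  wlog hpos : ∀ x, x ≠ 0 → q₁ x = 0 → 0 < q₂ x generalizing q₂
  · refine this (-q₂) (fun a b hab v hv => hnd a (-b) (by simpa using hab) v ?_) ?_ ?_
    · simpa using hv
    · simpa using hno
    · push Not at hpos
      obtain ⟨v, hv0, hv, hv₂⟩ := hpos
      intro u hu0 hu
      by_contra hu₂
      have hu₂' : 0 < q₂ u := lt_of_le_of_ne (by simpa using hu₂) (hno u hu0 hu).symm
      obtain ⟨x, hx0, hx₁, hx₂⟩ := QuadraticForm.exists_common_isotropic_of_sign_change hE q₁ q₂
        hu hv hu₂' (lt_of_le_of_ne hv₂ (hno v hv0 hv))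
      exact hno x hx0 hx₁ hx₂
  wlog hq₁ : ∃ x, 0 < q₁ x generalizing q₁
  · refine this (-q₁) (fun a b hab v hv => hnd (-a) b (by simpa using hab) v ?_) ?_ ?_ ?_
    · simpa using hv
    · simpa using hno
    · simpa using hpos
    · by_contra! hneg
      push Not at hq₁
      have hzero : q₁ = 0 := by
        ext x
        exact le_antisymm (hq₁ x) (by simpa using hneg x)
      have hone := hnd 1 0 (by simp) (fun _ => 1) (by simp [hzero, QuadraticMap.polar])
      exact one_ne_zero (congrFun hone ⟨0, by omega⟩)
  obtain ⟨α, x, hx0, hx⟩ := QuadraticForm.exists_mem_radical_sub_smul q₁ q₂ hpos hq₁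
  refine hx0 (hnd (-α) 1 (by simp) x fun w => ?_)
  rw [← hx w]
  congr 2
  module
end

section
/- Let G be a group generated by a finite subset S such that for all s, t ∈ S one has s^{-1} t s ∈ {t, t^{-1}}. If every element of S has finite order, then G is a finite group. -/
open scoped Pointwise in
/-- A finite set of finite-order elements, each generating a normal subgroup, generates a finite
subgroup. -/
theorem Subgroup.finite_closure_of_normal_zpowers {G : Type*} [Group G] (S : Finset G)
    (hnormal : ∀ s ∈ S, (Subgroup.zpowers s).Normal) (hord : ∀ s ∈ S, IsOfFinOrder s) :
    (Subgroup.closure (S : Set G) : Set G).Finite := by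
  classical
  induction S using Finset.induction_on with
  | empty => simp
  | insert a S _ ih =>
    have := hnormal a (Finset.mem_insert_self a S)
    rw [Finset.coe_insert, Set.insert_eq, Subgroup.closure_union, ← Subgroup.zpowers_eq_closure,
      Subgroup.normal_mul]
    exact (finite_zpowers.mpr (hord a (Finset.mem_insert_self a S))).mul
      (ih (fun s hs => hnormal s (Finset.mem_insert_of_mem hs))
        fun s hs => hord s (Finset.mem_insert_of_mem hs))

/-- If conjugation by each element of a generating set fixes or inverts `t`, then `t` generates a
normal subgroup. -/
theorem Subgroup.normal_zpowers_of_closure_eq_top {G : Type*} [Group G] {S : Set G}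
    (hgen : Subgroup.closure S = ⊤) {t : G}
    (hconj : ∀ s ∈ S, s⁻¹ * t * s = t ∨ s⁻¹ * t * s = t⁻¹) :
    (Subgroup.zpowers t).Normal := by
  rw [← Subgroup.normalizer_eq_top_iff, eq_top_iff, ← hgen, Subgroup.closure_le]
  intro s hs
  rw [SetLike.mem_coe, ← inv_mem_iff, Subgroup.mem_normalizer_iff_map_conj_eq,
    MonoidHom.map_zpowers]
  rcases hconj s hs with h | h <;> simp [h]

/-- Let `G` be a group generated by a finite subset `S` such that
`s⁻¹ t s ∈ {t, t⁻¹}` for all `s, t ∈ S`. If every element of `S` has finite order,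
then `G` is finite. -/
theorem finite_of_generators_semiNormal_finiteOrder
    {G : Type*} [Group G] (S : Finset G)
    (hgen : Subgroup.closure (S : Set G) = ⊤)
    (hconj : ∀ s ∈ S, ∀ t ∈ S, s⁻¹ * t * s = t ∨ s⁻¹ * t * s = t⁻¹)
    (hord : ∀ s ∈ S, IsOfFinOrder s) :
    Finite G := by
  exact Set.finite_univ_iff.mp (by
    simpa [hgen] using Subgroup.finite_closure_of_normal_zpowers S
      (fun t ht => Subgroup.normal_zpowers_of_closure_eq_top hgen fun s hs => hconj s hs t ht)
      hord)
end
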